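/- Local Poincaré inequality near the boundary for connected-boundary domains: let p > N − 1, let Ω ⊂ ℝ^N be a bounded domain with connected boundary, set r = ρ_Ω(1+√N), and let x ∈ ∂Ω. Then for all u ∈ C_0^∞(Ω) (extended by zero outside Ω), ∫_{B_r(x)} |u|^p dx ≤ C(N,p) r^p ∫_{B_r(x)} |∇u|^p dx, with C(N,p) depending only on N and p. -/

import Mathlib

open MeasureTheory Metric Set

noncomputable def pEigen (N : ℕ) (p : ℝ) (Ω : Set (EuclideanSpace ℝ (Fin N))) : ℝ :=
  sInf { t | ∃ u : EuclideanSpace ℝ (Fin N) → ℝ, ContDiff ℝ (⊤ : ℕ∞) u ∧ HasCompactSupport u ∧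
      tsupport u ⊆ Ω ∧ u ≠ 0 ∧
      t = (∫ x in Ω, ‖fderiv ℝ u x‖ ^ p) / (∫ x in Ω, |u x| ^ p) }

noncomputable def inradius (N : ℕ) (Ω : Set (EuclideanSpace ℝ (Fin N))) : ℝ :=
  sSup { r | ∃ c : EuclideanSpace ℝ (Fin N), Metric.ball c r ⊆ Ω }


theorem aux_jensen {p : ℝ} (hp : 1 ≤ p) (G : ℝ → ENNReal) (hG : Measurable G) :
    (∫⁻ t in Ioc (0:ℝ) 1, G t) ^ p ≤ ∫⁻ t in Ioc (0:ℝ) 1, G t ^ p := by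
  have hp0 : 0 < p := by linarith
  have : IsProbabilityMeasure (volume.restrict (Ioc (0:ℝ) 1)) := ⟨by simp⟩
  have h := eLpNorm'_le_eLpNorm'_of_exponent_le (f := G) one_pos hp
    (volume.restrict (Ioc (0:ℝ) 1)) hG.aestronglyMeasurable
  simp only [eLpNorm'_eq_lintegral_enorm, enorm_eq_self, ENNReal.rpow_one, div_one] at h
  calc _ ≤ ((∫⁻ t in Ioc (0:ℝ) 1, G t ^ p) ^ (1/p)) ^ p := ENNReal.rpow_le_rpow h hp0.le
    _ = _ := by rw [← ENNReal.rpow_mul, one_div_mul_cancel hp0.ne', ENNReal.rpow_one]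

theorem aux_path {E : Type*} [NormedAddCommGroup E] [NormedSpace ℝ E]
    {p k : ℝ} (hp : 1 ≤ p) (hk : 1 ≤ k) (u : E → ℝ) (hu : ContDiff ℝ 1 u) (y z : E) :
    ‖u y - u z‖ₑ ^ p ≤ (ENNReal.ofReal k * ‖y - z‖ₑ) ^ p *
      ∫⁻ t in Ioc (0:ℝ) 1, ENNReal.ofReal (t ^ ((k-1)*p)) * ‖fderiv ℝ u (z + t ^ k • (y - z))‖ₑ ^ p := by
  have hp0 : 0 < p := by linarith
  have hk0 : 0 < k := by linarith
  have hc1 : Continuous fun t : ℝ => t ^ (k-1) := Real.continuous_rpow_const (by linarith)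
  have hc2 : Continuous fun t : ℝ => t ^ k := Real.continuous_rpow_const (by linarith)
  have hfd : Continuous (fderiv ℝ u) := hu.continuous_fderiv one_ne_zero
  have hγ : Continuous fun t : ℝ => z + t ^ k • (y - z) := by fun_prop
  have hFTC : ∫ t in (0:ℝ)..1, (fderiv ℝ u (z + t ^ k • (y - z))) ((k * t ^ (k-1)) • (y - z))
      = u y - u z := by
    rw [intervalIntegral.integral_eq_sub_of_hasDerivAt (f := fun t : ℝ => u (z + t ^ k • (y - z)))]
    · simp [Real.zero_rpow hk0.ne']
    · intro t _
      have h1 : HasDerivAt (fun t : ℝ => z + t ^ k • (y - z)) ((k * t ^ (k-1)) • (y - z)) t :=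
        ((Real.hasDerivAt_rpow_const (Or.inr hk)).smul_const _).const_add _
      exact (hu.differentiable one_ne_zero _).hasFDerivAt.comp_hasDerivAt t h1
    · apply Continuous.intervalIntegrable
      exact (hfd.comp hγ).clm_apply (by fun_prop)
  rw [← hFTC, intervalIntegral.integral_of_le zero_le_one]
  have hm : Measurable fun t : ℝ => ENNReal.ofReal (t ^ (k-1)) * ‖fderiv ℝ u (z + t ^ k • (y - z))‖ₑ :=
    hc1.measurable.ennreal_ofReal.mul (hfd.comp hγ).enorm.measurable
  calc _ ≤ (∫⁻ t in Ioc (0:ℝ) 1, (ENNReal.ofReal k * ‖y - z‖ₑ) * (ENNReal.ofReal (t ^ (k-1)) *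
        ‖fderiv ℝ u (z + t ^ k • (y - z))‖ₑ)) ^ p := by
        refine ENNReal.rpow_le_rpow ((enorm_integral_le_lintegral_enorm _).trans ?_) hp0.le
        refine setLIntegral_mono (hm.const_mul _) fun t ht => ?_
        refine (ContinuousLinearMap.le_opENorm _ _).trans (le_of_eq ?_)
        have : 0 ≤ t ^ (k-1) := Real.rpow_nonneg ht.1.le _
        rw [enorm_smul, Real.enorm_eq_ofReal (by positivity), ENNReal.ofReal_mul hk0.le]
        ring
    _ = (ENNReal.ofReal k * ‖y - z‖ₑ) ^ p * (∫⁻ t in Ioc (0:ℝ) 1, (ENNReal.ofReal (t ^ (k-1)) *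
        ‖fderiv ℝ u (z + t ^ k • (y - z))‖ₑ)) ^ p := by
        rw [lintegral_const_mul _ hm, ENNReal.mul_rpow_of_nonneg _ _ hp0.le]
    _ ≤ _ := by
        gcongr
        refine (aux_jensen hp _ hm).trans (le_of_eq ?_)
        refine setLIntegral_congr_fun measurableSet_Ioc fun t ht => ?_
        rw [ENNReal.mul_rpow_of_nonneg _ _ hp0.le, ENNReal.ofReal_rpow_of_nonneg
          (Real.rpow_nonneg ht.1.le _) hp0.le, ← Real.rpow_mul ht.1.le]

theorem aux_scale {V : Type*} [NormedAddCommGroup V] [NormedSpace ℝ V] [FiniteDimensional ℝ V]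
    [MeasurableSpace V] [BorelSpace V] (μ : Measure V) [μ.IsAddHaarMeasure]
    (D : Set V) (hD : Convex ℝ D) (hDm : MeasurableSet D) (w0 : V) (hw : w0 ∈ D) (c : ℝ) (hc : 0 < c) (hc1 : c ≤ 1)
    (g : V → ENNReal) (hg : Measurable g) :
    ∫⁻ w in D, g (w0 + c • (w - w0)) ∂μ ≤
      ENNReal.ofReal ((c ^ Module.finrank ℝ V)⁻¹) * ∫⁻ w in D, g w ∂μ := by
  set F := D.indicator g with hF
  have hFm : Measurable F := hg.indicator hDm
  calc ∫⁻ w in D, g (w0 + c • (w - w0)) ∂μ ≤ ∫⁻ w, F ((w0 - c • w0) + c • w) ∂μ := by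
        rw [← lintegral_indicator hDm]
        refine lintegral_mono fun w => ?_
        by_cases h : w ∈ D
        · have e : (w0 - c • w0) + c • w = w0 + c • (w - w0) := by rw [smul_sub]; abel
          have : w0 + c • (w - w0) ∈ D := hD.add_smul_sub_mem hw h ⟨hc.le, hc1⟩
          rw [e]; simp [h, hF, this]
        · simp [h]
    _ = ∫⁻ v, F ((w0 - c • w0) + v) ∂(Measure.map (c • ·) μ) := by
        rw [lintegral_map (f := fun v => F ((w0 - c • w0) + v)) (by fun_prop) (by fun_prop)]
    _ = ENNReal.ofReal ((c ^ Module.finrank ℝ V)⁻¹) * ∫⁻ w in D, g w ∂μ := by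
        rw [Measure.map_addHaar_smul μ hc.ne', lintegral_smul_measure, lintegral_add_left_eq_self,
          hF, lintegral_indicator hDm, abs_of_pos (by positivity)]
        rfl

theorem aux_morrey {E V : Type*} [NormedAddCommGroup E] [NormedSpace ℝ E]
    [NormedAddCommGroup V] [NormedSpace ℝ V] [FiniteDimensional ℝ V]
    [MeasurableSpace V] [BorelSpace V] (μ : Measure V) [μ.IsAddHaarMeasure]
    {p : ℝ} (hp : 1 ≤ p) (hpd : (Module.finrank ℝ V : ℝ) < p)
    (u : E → ℝ) (hu : ContDiff ℝ 1 u) (ι : V → E) (hι : Continuous ι)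
    (D : Set V) (hD : Convex ℝ D) (hDm : MeasurableSet D) (w0 : V) (hw : w0 ∈ D)
    (hι2 : ∀ (c : ℝ) (w : V), ι (w0 + c • (w - w0)) = ι w0 + c • (ι w - ι w0))
    (r : ℝ) (hr : ∀ w ∈ D, ‖ι w - ι w0‖ ≤ r) (h0 : u (ι w0) = 0) :
    ∫⁻ w in D, ‖u (ι w)‖ₑ ^ p ∂μ ≤
      (ENNReal.ofReal (p / (p - Module.finrank ℝ V)) * ENNReal.ofReal r) ^ p *
        ∫⁻ w in D, ‖fderiv ℝ u (ι w)‖ₑ ^ p ∂μ := by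
  have hp0 : 0 < p := by linarith
  set d : ℝ := (Module.finrank ℝ V : ℝ) with hd
  have hd0 : 0 ≤ d := by positivity
  have hpd' : 0 < p - d := by linarith
  set k : ℝ := p / (p - d) with hkdef
  have hk : 1 ≤ k := by rw [hkdef, le_div_iff₀ hpd']; linarith
  have hkk : (k - 1) * p - k * d = 0 := by rw [hkdef]; field_simp; ring
  have hk0 : 0 < k := by linarith
  have hfd : Continuous (fderiv ℝ u) := hu.continuous_fderiv one_ne_zero
  have hc1 : Continuous fun t : ℝ => t ^ ((k-1)*p) :=
    Real.continuous_rpow_const (mul_nonneg (by linarith) hp0.le)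
  have hc2 : Continuous fun t : ℝ => t ^ k := Real.continuous_rpow_const (by linarith)
  have hgm : Measurable fun w => ‖fderiv ℝ u (ι w)‖ₑ ^ p :=
    ((hfd.comp hι).enorm.measurable).pow_const p
  have hcc : Continuous fun q : V × ℝ => fderiv ℝ u (ι w0 + (q.2 ^ k) • (ι q.1 - ι w0)) :=
    hfd.comp (by
      have : Continuous fun q : V × ℝ => q.2 ^ k := hc2.comp continuous_snd
      fun_prop)
  have hjm : Measurable fun q : V × ℝ => ENNReal.ofReal (q.2 ^ ((k-1)*p)) *
      ‖fderiv ℝ u (ι w0 + (q.2 ^ k) • (ι q.1 - ι w0))‖ₑ ^ p :=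
    ((hc1.measurable.comp measurable_snd).ennreal_ofReal).mul (hcc.enorm.measurable.pow_const p)
  have hjm1 : Measurable fun w : V => ∫⁻ t in Ioc (0:ℝ) 1, ENNReal.ofReal (t ^ ((k-1)*p)) *
      ‖fderiv ℝ u (ι w0 + (t ^ k) • (ι w - ι w0))‖ₑ ^ p := hjm.lintegral_prod_right'
  calc ∫⁻ w in D, ‖u (ι w)‖ₑ ^ p ∂μ
      ≤ ∫⁻ w in D, (ENNReal.ofReal k * ENNReal.ofReal r) ^ p *
      (∫⁻ t in Ioc (0:ℝ) 1, ENNReal.ofReal (t ^ ((k-1)*p)) *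
        ‖fderiv ℝ u (ι w0 + t ^ k • (ι w - ι w0))‖ₑ ^ p) ∂μ := by
        refine setLIntegral_mono (hjm1.const_mul _) fun w hwD => ?_
        have := aux_path hp hk u hu (ι w) (ι w0)
        rw [h0, sub_zero] at this
        refine this.trans ?_
        gcongr
        rw [← ofReal_norm]
        exact ENNReal.ofReal_le_ofReal (hr w hwD)
    _ = (ENNReal.ofReal k * ENNReal.ofReal r) ^ p * ∫⁻ t in Ioc (0:ℝ) 1, ∫⁻ w in D,
        ENNReal.ofReal (t ^ ((k-1)*p)) *
        ‖fderiv ℝ u (ι w0 + t ^ k • (ι w - ι w0))‖ₑ ^ p ∂μ := by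
        rw [lintegral_const_mul _ hjm1, lintegral_lintegral_swap hjm.aemeasurable]
    _ ≤ (ENNReal.ofReal k * ENNReal.ofReal r) ^ p * ∫⁻ t in Ioc (0:ℝ) 1,
        ∫⁻ w in D, ‖fderiv ℝ u (ι w)‖ₑ ^ p ∂μ := by
        refine mul_le_mul_right ?_ _
        refine setLIntegral_mono measurable_const fun t ht => ?_
        have ht0 : 0 < t := ht.1
        have hs := aux_scale μ D hD hDm w0 hw (t ^ k) (Real.rpow_pos_of_pos ht0 _)
          (Real.rpow_le_one ht0.le ht.2 hk0.le) _ hgm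
        simp only [hι2] at hs
        rw [lintegral_const_mul' _ _ ENNReal.ofReal_ne_top]
        calc _ ≤ ENNReal.ofReal (t ^ ((k-1)*p)) * _ := mul_le_mul_right hs _
          _ = _ := by
            rw [← mul_assoc, ← ENNReal.ofReal_mul (Real.rpow_nonneg ht0.le _),
              ← Real.rpow_natCast, ← Real.rpow_mul ht0.le, ← Real.rpow_neg ht0.le, ← Real.rpow_add ht0,
              ← hd, ← sub_eq_add_neg, hkk]
            simp
    _ = _ := by simp

theorem aux_avg {E : Type*} [NormedAddCommGroup E] [NormedSpace ℝ E] [FiniteDimensional ℝ E]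
    [MeasurableSpace E] [BorelSpace E] (μ : Measure E) [μ.IsAddHaarMeasure]
    (B : Set E) (hB : Convex ℝ B) (hBm : MeasurableSet B) (g : E → ENNReal) (hgm : Measurable g) :
    ∀ t ∈ Ioc (0:ℝ) 1, ∫⁻ y in B, ∫⁻ z in B, g (z + t • (y - z)) ∂μ ∂μ ≤
      (2 ^ Module.finrank ℝ E * μ B) * ∫⁻ w in B, g w ∂μ := by
  have half : ∀ t : ℝ, 1/2 ≤ t → t ≤ 1 → ∀ z ∈ B, ∫⁻ y in B, g (z + t • (y - z)) ∂μ ≤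
      2 ^ Module.finrank ℝ E * ∫⁻ w in B, g w ∂μ := by
    intro t h1 h2 z hz
    have ht0 : 0 < t := by linarith
    refine (aux_scale μ B hB hBm z hz t ht0 h2 g hgm).trans ?_
    gcongr
    have : (2 : ENNReal) ^ Module.finrank ℝ E = ENNReal.ofReal (2 ^ Module.finrank ℝ E) := by
      rw [ENNReal.ofReal_pow (by norm_num)]; simp
    rw [this]
    apply ENNReal.ofReal_le_ofReal
    rw [← inv_pow]
    gcongr
    rw [inv_le_comm₀ ht0 (by norm_num)]; linarith
  intro t ht
  rcases le_total (1/2) t with h | h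
  · rw [lintegral_lintegral_swap]
    · calc _ ≤ ∫⁻ z in B, 2 ^ Module.finrank ℝ E * ∫⁻ w in B, g w ∂μ ∂μ :=
            setLIntegral_mono measurable_const fun z hz => half t h ht.2 z hz
        _ = _ := by rw [setLIntegral_const]; ring
    · apply Measurable.aemeasurable
      exact hgm.comp (by fun_prop)
  · calc _ ≤ ∫⁻ z in B, 2 ^ Module.finrank ℝ E * ∫⁻ w in B, g w ∂μ ∂μ := by
            refine setLIntegral_mono measurable_const fun y hy => ?_
            refine le_trans (le_of_eq ?_) (half (1 - t) (by linarith) (by linarith [ht.1]) y hy)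
            congr 1
            ext z
            congr 1
            module
        _ = _ := by rw [setLIntegral_const]; ring

theorem aux_swap {E : Type*} [NormedAddCommGroup E] [NormedSpace ℝ E] [FiniteDimensional ℝ E]
    [MeasurableSpace E] [BorelSpace E] (μ : Measure E) [μ.IsAddHaarMeasure]
    (B : Set E) (g : E → ENNReal) (hgm : Measurable g) :
    ∫⁻ y in B, ∫⁻ z in B, (∫⁻ t in Ioc (0:ℝ) 1, g (z + t • (y - z))) ∂μ ∂μ =
      ∫⁻ t in Ioc (0:ℝ) 1, ∫⁻ y in B, ∫⁻ z in B, g (z + t • (y - z)) ∂μ ∂μ := by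
  have e1 : ∀ y, ∫⁻ z in B, (∫⁻ t in Ioc (0:ℝ) 1, g (z + t • (y - z))) ∂μ =
      ∫⁻ t in Ioc (0:ℝ) 1, ∫⁻ z in B, g (z + t • (y - z)) ∂μ := fun y => by
    rw [lintegral_lintegral_swap]
    exact (hgm.comp (by fun_prop)).aemeasurable
  simp only [e1]
  rw [lintegral_lintegral_swap]
  apply Measurable.aemeasurable
  have : Measurable fun q : (E × ℝ) × E => g (q.2 + q.1.2 • (q.1.1 - q.2)) :=
    hgm.comp (by fun_prop)
  exact this.lintegral_prod_right'

theorem aux_meas {E : Type*} [NormedAddCommGroup E] [NormedSpace ℝ E] [FiniteDimensional ℝ E]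
    [MeasurableSpace E] [BorelSpace E] (μ : Measure E) [μ.IsAddHaarMeasure]
    (B : Set E) (g : E → ENNReal) (hgm : Measurable g) :
    (Measurable fun q : E × E => ∫⁻ t in Ioc (0:ℝ) 1, g (q.2 + t • (q.1 - q.2))) ∧
    (Measurable fun y : E => ∫⁻ z in B, (∫⁻ t in Ioc (0:ℝ) 1, g (z + t • (y - z))) ∂μ) := by
  have hm3 : Measurable fun q : (E × E) × ℝ => g (q.1.2 + q.2 • (q.1.1 - q.1.2)) :=
    hgm.comp (by fun_prop)
  have hm2 : Measurable fun q : E × E => ∫⁻ t in Ioc (0:ℝ) 1, g (q.2 + t • (q.1 - q.2)) :=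
    hm3.lintegral_prod_right'
  exact ⟨hm2, hm2.lintegral_prod_right'⟩

theorem aux_pair {E : Type*} [NormedAddCommGroup E] [NormedSpace ℝ E] [FiniteDimensional ℝ E]
    [MeasurableSpace E] [BorelSpace E] (μ : Measure E) [μ.IsAddHaarMeasure]
    {p : ℝ} (hp : 1 ≤ p) (u : E → ℝ) (hu : ContDiff ℝ 1 u) 
    (B : Set E) (hB : Convex ℝ B) (hBm : MeasurableSet B)
    (r : ℝ) (hr : ∀ y ∈ B, ∀ z ∈ B, ‖y - z‖ ≤ r) :
    ∫⁻ y in B, ∫⁻ z in B, ‖u y - u z‖ₑ ^ p ∂μ ∂μ ≤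
      ENNReal.ofReal r ^ p * ((2 ^ Module.finrank ℝ E * μ B) * ∫⁻ w in B, ‖fderiv ℝ u w‖ₑ ^ p ∂μ) := by
  have hp0 : 0 < p := by linarith
  have hfd : Continuous (fderiv ℝ u) := hu.continuous_fderiv one_ne_zero
  have hgm : Measurable fun w => ‖fderiv ℝ u w‖ₑ ^ p := hfd.enorm.measurable.pow_const p
  obtain ⟨g, hg⟩ : ∃ g : E → ENNReal, g = fun w => ‖fderiv ℝ u w‖ₑ ^ p := ⟨_, rfl⟩
  have hgx : ∀ w, ‖fderiv ℝ u w‖ₑ ^ p = g w := fun w => by rw [hg]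
  rw [← hg] at hgm
  simp only [hgx]
  have key := aux_avg μ B hB hBm g hgm
  obtain ⟨hm2, hm1⟩ := aux_meas μ B g hgm
  calc ∫⁻ y in B, ∫⁻ z in B, ‖u y - u z‖ₑ ^ p ∂μ ∂μ
      ≤ ∫⁻ y in B, ENNReal.ofReal r ^ p *
          ∫⁻ z in B, (∫⁻ t in Ioc (0:ℝ) 1, g (z + t • (y - z))) ∂μ ∂μ := by
        refine setLIntegral_mono (hm1.const_mul _) fun y hy => ?_
        have hmy : Measurable fun z : E => ∫⁻ t in Ioc (0:ℝ) 1, g (z + t • (y - z)) :=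
          hm2.comp measurable_prodMk_left
        rw [← lintegral_const_mul _ hmy]
        refine setLIntegral_mono (hmy.const_mul _) fun z hz => ?_
        have := aux_path hp le_rfl u hu y z
        simp only [sub_self, zero_mul, Real.rpow_zero, ENNReal.ofReal_one, one_mul, Real.rpow_one, hgx] at this
        refine this.trans ?_
        gcongr
        rw [← ofReal_norm]
        exact ENNReal.ofReal_le_ofReal (hr y hy z hz)
    _ = ENNReal.ofReal r ^ p * ∫⁻ t in Ioc (0:ℝ) 1, ∫⁻ y in B, ∫⁻ z in B, g (z + t • (y - z)) ∂μ ∂μ := by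
        rw [lintegral_const_mul _ hm1]
        congr 1
        exact aux_swap μ B g hgm
    _ ≤ ENNReal.ofReal r ^ p * ∫⁻ t in Ioc (0:ℝ) 1,
          (2 ^ Module.finrank ℝ E * μ B) * ∫⁻ w in B, g w ∂μ := by
        refine mul_le_mul_right ?_ _
        exact setLIntegral_mono measurable_const key
    _ = _ := by simp

theorem aux_ray {E : Type*} [NormedAddCommGroup E] [NormedSpace ℝ E] (Ω : Set E)
    (hb : Bornology.IsBounded Ω) (c x : E) (hc : c ∈ Ω) (hcx : c ≠ x) (ho : IsOpen Ω) :
    ∃ t : ℝ, 0 ≤ t ∧ c + t • (c - x) ∈ frontier Ω := by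
  by_contra! hcon
  have hS : IsPreconnected ((fun t : ℝ => c + t • (c - x)) '' Ici 0) :=
    isPreconnected_Ici.image _ (by fun_prop)
  have hsub : ((fun t : ℝ => c + t • (c - x)) '' Ici 0) ⊆ Ω := by
    refine hS.subset_of_closure_inter_subset ho ⟨c, ⟨0, by simp, by simp⟩, hc⟩ ?_
    rintro y ⟨hy, t, ht, rfl⟩
    by_contra hn
    exact hcon t ht ⟨hy, by rwa [ho.interior_eq]⟩
  obtain ⟨M, hM⟩ := (Metric.isBounded_iff_subset_closedBall c).1 hb
  have hpos : 0 < ‖c - x‖ := norm_pos_iff.2 (sub_ne_zero.2 hcx)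
  have h := hM (hsub ⟨(|M| + 1) / ‖c - x‖, by simp only [mem_Ici]; positivity, rfl⟩)
  simp only [mem_closedBall, dist_eq_norm, add_sub_cancel_left, norm_smul] at h
  rw [Real.norm_of_nonneg (by positivity), div_mul_cancel₀ _ hpos.ne'] at h
  linarith [le_abs_self M]

theorem aux_norm_le {n : ℕ} (v : EuclideanSpace ℝ (Fin (n+1))) (a : ℝ) (ha : 0 ≤ a)
    (h : ∀ i, |v i| ≤ a) : ‖v‖ ≤ (n+1) * a := by
  rw [EuclideanSpace.norm_eq]
  apply Real.sqrt_le_iff.2 ⟨by positivity, ?_⟩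
  calc ∑ i, ‖v i‖ ^ 2 ≤ ∑ i : Fin (n+1), a ^ 2 := by
        gcongr with i
        exact h i
    _ = (n+1) * a^2 := by simp
    _ ≤ _ := by
        have : (0:ℝ) ≤ n := by positivity
        nlinarith [sq_nonneg a, mul_nonneg this (sq_nonneg a), mul_nonneg (mul_nonneg this this) (sq_nonneg a)]

noncomputable def auxPhi {n : ℕ} (j : Fin (n+1)) (q : ℝ × (Fin n → ℝ)) : EuclideanSpace ℝ (Fin (n+1)) :=
  WithLp.toLp 2 (j.insertNth q.1 q.2)

theorem auxPhi_cont {n : ℕ} (j : Fin (n+1)) : Continuous (auxPhi j) := by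
  unfold auxPhi
  apply (PiLp.continuous_toLp 2 _).comp
  exact Continuous.finInsertNth (A := fun _ => ℝ) j continuous_fst continuous_snd

theorem auxPhi_mp {n : ℕ} (j : Fin (n+1)) : MeasurePreserving (auxPhi j) volume volume := by
  have h1 := (volume_preserving_piFinSuccAbove (fun _ : Fin (n+1) => ℝ) j).symm
  exact (PiLp.volume_preserving_toLp (Fin (n+1))).comp h1

theorem auxPhi_same {n : ℕ} (j : Fin (n+1)) (q) : auxPhi j q j = q.1 := by simp [auxPhi]

theorem auxPhi_succ {n : ℕ} (j : Fin (n+1)) (q) (i) : auxPhi j q (j.succAbove i) = q.2 i := by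
  simp [auxPhi]

theorem aux_slice {n : ℕ} {p : ℝ} (hp : 1 ≤ p) (hpn : (n:ℝ) < p)
    (u : EuclideanSpace ℝ (Fin (n+1)) → ℝ) (hu : ContDiff ℝ 1 u)
    (x : EuclideanSpace ℝ (Fin (n+1))) (r : ℝ) (j : Fin (n+1)) (T : Set ℝ) (hT : MeasurableSet T)
    (hz : ∀ s ∈ T, ∃ z ∈ ball x r, z j = s ∧ u z = 0) :
    ∫⁻ y in ball x r ∩ {y | y j ∈ T}, ‖u y‖ₑ ^ p ≤
      (ENNReal.ofReal (p / (p - n)) * ENNReal.ofReal (2 * r)) ^ p *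
        ∫⁻ y in ball x r, ‖fderiv ℝ u y‖ₑ ^ p := by
  have hfd : Continuous (fderiv ℝ u) := hu.continuous_fderiv one_ne_zero
  have hTm : MeasurableSet {y : EuclideanSpace ℝ (Fin (n+1)) | y j ∈ T} :=
    (show Measurable fun y : EuclideanSpace ℝ (Fin (n+1)) => y j by fun_prop) hT
  have hEm : MeasurableSet (ball x r ∩ {y | y j ∈ T}) := measurableSet_ball.inter hTm
  have hm1 : Measurable fun y => ‖u y‖ₑ ^ p := hu.continuous.enorm.measurable.pow_const p
  have hm2 : Measurable fun y => ‖fderiv ℝ u y‖ₑ ^ p := hfd.enorm.measurable.pow_const p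
  have hi1 := hm1.indicator hEm
  have hi2 := hm2.indicator (measurableSet_ball (x := x) (ε := r))
  have hΦm := (auxPhi_mp j).measurable
  have hq1 : Measurable fun q => (ball x r ∩ {y | y j ∈ T}).indicator (fun y => ‖u y‖ₑ ^ p)
    (auxPhi j q) := hi1.comp hΦm
  have hq2 : Measurable fun q => (ball x r).indicator (fun y => ‖fderiv ℝ u y‖ₑ ^ p)
    (auxPhi j q) := hi2.comp hΦm
  rw [← lintegral_indicator hEm, ← lintegral_indicator measurableSet_ball,
    ← (auxPhi_mp j).lintegral_comp hi1, ← (auxPhi_mp j).lintegral_comp hi2,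
    Measure.volume_eq_prod, lintegral_prod _ hq1.aemeasurable,
    lintegral_prod _ hq2.aemeasurable,
    ← lintegral_const_mul _ hq2.lintegral_prod_right']
  refine lintegral_mono fun s => ?_
  by_cases hs : s ∈ T
  · obtain ⟨z, hzB, hzj, hz0⟩ := hz s hs
    have hιc : Continuous fun w : Fin n → ℝ => auxPhi j (s, w) := (auxPhi_cont j).comp (by fun_prop)
    set w0 : Fin n → ℝ := fun i => z (j.succAbove i) with hw0
    have hzw : auxPhi j (s, w0) = z := by
      ext i
      refine Fin.succAboveCases j ?_ (fun i => ?_) i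
      · rw [auxPhi_same, hzj]
      · rw [auxPhi_succ]
    have haff : ∀ (c d : ℝ) (w w' : Fin n → ℝ), c + d = 1 →
        auxPhi j (s, c • w + d • w') = c • auxPhi j (s, w) + d • auxPhi j (s, w') := by
      intro c d w w' hcd
      ext i
      refine Fin.succAboveCases j ?_ (fun i => ?_) i
      · simp only [auxPhi_same, PiLp.add_apply, PiLp.smul_apply, smul_eq_mul]
        rw [← add_mul, hcd, one_mul]
      · simp only [auxPhi_succ, PiLp.add_apply, PiLp.smul_apply, Pi.add_apply, Pi.smul_apply]
    set D : Set (Fin n → ℝ) := (fun w => auxPhi j (s, w)) ⁻¹' ball x r with hD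
    have hDm : MeasurableSet D := hιc.measurable measurableSet_ball
    have hDc : Convex ℝ D := by
      intro w hw w' hw' c d hc hd hcd
      simp only [hD, mem_preimage] at hw hw' ⊢
      rw [haff c d w w' hcd]
      exact convex_ball x r hw hw' hc hd hcd
    have hmor := aux_morrey (volume : Measure (Fin n → ℝ)) hp (by simpa using hpn) u hu
      (fun w => auxPhi j (s, w)) hιc D hDc hDm w0 (by simpa [hD, hzw] using hzB)
      (by
        intro c w
        have : w0 + c • (w - w0) = (1 - c) • w0 + c • w := by module
        rw [this, haff _ _ _ _ (by ring)]
        module) (2 * r)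
      (by
        intro w hw
        simp only [hzw]
        have h1 : dist (auxPhi j (s, w)) x < r := hw
        have h2 : dist z x < r := hzB
        rw [← dist_eq_norm]
        linarith [dist_triangle_right (auxPhi j (s, w)) z x])
      (by simpa [hzw] using hz0)
    rw [← lintegral_indicator hDm, ← lintegral_indicator hDm] at hmor
    simp only [Module.finrank_fintype_fun_eq_card, Fintype.card_fin] at hmor
    refine le_trans (le_of_eq ?_) (hmor.trans (le_of_eq ?_))
    · congr 1; ext w
      simp [indicator, hD, auxPhi_same, hs]
    · congr 1
  · have : ∀ w, (ball x r ∩ {y | y j ∈ T}).indicator (fun y => ‖u y‖ₑ ^ p) (auxPhi j (s, w)) = 0 := by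
      intro w
      apply indicator_of_notMem
      simp [auxPhi_same, hs]
    simp [this]

theorem aux_vol {n : ℕ} (x : EuclideanSpace ℝ (Fin (n+1))) (r a : ℝ) (ha : 0 ≤ a) (har : (n+1) * a < r)
    (j : Fin (n+1)) (T : Set ℝ) (hT : MeasurableSet T) (hTa : T ⊆ Icc (x j - a) (x j + a)) :
    volume T * ENNReal.ofReal (2 * a) ^ n ≤ volume (ball x r ∩ {y | y j ∈ T}) := by
  have hTm : MeasurableSet {y : EuclideanSpace ℝ (Fin (n+1)) | y j ∈ T} :=
    (show Measurable fun y : EuclideanSpace ℝ (Fin (n+1)) => y j by fun_prop) hT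
  rw [← (auxPhi_mp j).measure_preimage (measurableSet_ball.inter hTm).nullMeasurableSet]
  calc volume T * ENNReal.ofReal (2 * a) ^ n
      = volume (T ×ˢ (Set.pi univ fun i : Fin n => Icc (x (j.succAbove i) - a) (x (j.succAbove i) + a))) := by
        rw [Measure.volume_eq_prod, Measure.prod_prod, volume_pi_pi]
        simp only [Real.volume_Icc]
        congr 1
        rw [Finset.prod_congr rfl (g := fun _ => ENNReal.ofReal (2 * a))
          (fun i _ => by congr 1; ring)]
        simp
    _ ≤ _ := by
        refine measure_mono ?_
        rintro ⟨s, w⟩ ⟨hs, hw⟩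
        refine ⟨?_, by simpa [auxPhi_same] using hs⟩
        rw [mem_ball, dist_eq_norm]
        refine lt_of_le_of_lt (aux_norm_le _ a ha fun i => ?_) har
        refine Fin.succAboveCases j ?_ (fun i => ?_) i
        · have := hTa hs
          rw [PiLp.sub_apply, auxPhi_same, abs_le]
          constructor <;> linarith [this.1, this.2]
        · have := hw i (mem_univ i)
          rw [PiLp.sub_apply, auxPhi_succ, abs_le]
          constructor <;> linarith [this.1, this.2]

theorem aux_pick {n : ℕ} (F : Set (EuclideanSpace ℝ (Fin (n+1)))) (hF : IsCompact F)
    (hFc : IsPreconnected F) (x : EuclideanSpace ℝ (Fin (n+1))) (hx : x ∈ F) (a : ℝ) (ha : 0 < a)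
    (z) (hz : z ∈ F) (hza : (n+1) * a < ‖z - x‖) :
    ∃ (j : Fin (n+1)) (T : Set ℝ), MeasurableSet T ∧ T ⊆ Icc (x j - a) (x j + a) ∧
      (∀ s ∈ T, ∃ y ∈ F, (∀ i, |y i - x i| ≤ a) ∧ y j = s) ∧
      ENNReal.ofReal (a / (2 * (n+1))) ≤ volume T := by
  set G : Set (EuclideanSpace ℝ (Fin (n+1))) := F ∩ {y | ∀ i, |y i - x i| ≤ a} with hG
  have hGc : IsCompact G := by
    refine hF.inter_right ?_
    simp only [ofPred_forall]
    exact isClosed_iInter fun i => isClosed_le (by fun_prop) continuous_const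
  set T : Fin (n+1) → Set ℝ := fun j => (fun y : EuclideanSpace ℝ (Fin (n+1)) => y j) '' G with hTdef
  have hTm : ∀ j, MeasurableSet (T j) := fun j => (hGc.image (by fun_prop)).measurableSet
  have hcov : Ioc 0 a ⊆ ⋃ j, ((fun s => x j + s) ⁻¹' T j ∪ (fun s => x j - s) ⁻¹' T j) := by
    intro s hs
    set m : EuclideanSpace ℝ (Fin (n+1)) → ℝ := fun y => ‖(fun i => y i - x i : Fin (n+1) → ℝ)‖ with hm
    have hmc : Continuous m := by fun_prop
    have hmx : m x = 0 := by
      have : (fun i => x i - x i : Fin (n+1) → ℝ) = 0 := by ext; simp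
      simp only [hm, this, norm_zero]
    have hmz : a < m z := by
      by_contra! hcon
      have := aux_norm_le (z - x) a ha.le fun i => by
        have := (norm_le_pi_norm (fun i => z i - x i : Fin (n+1) → ℝ) i).trans hcon
        simpa using this
      linarith
    obtain ⟨y, hyF, hy⟩ := hFc.intermediate_value hx hz hmc.continuousOn
      (show s ∈ Icc (m x) (m z) from ⟨by rw [hmx]; exact hs.1.le, hs.2.trans hmz.le⟩)
    have hle : ∀ i, |y i - x i| ≤ s := fun i => by
      have := (norm_le_pi_norm (fun i => y i - x i : Fin (n+1) → ℝ) i).trans hy.le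
      simpa using this
    obtain ⟨i, hi⟩ : ∃ i, s ≤ |y i - x i| := by
      by_contra! hcon
      exact absurd hy (ne_of_lt ((pi_norm_lt_iff hs.1).2 hcon))
    have hyG : y ∈ G := ⟨hyF, fun i => (hle i).trans hs.2⟩
    refine mem_iUnion.2 ⟨i, ?_⟩
    have heq := le_antisymm (hle i) hi
    rcases le_total 0 (y i - x i) with h | h
    · rw [abs_of_nonneg h] at heq
      exact Or.inl ⟨y, hyG, by simp only; linarith⟩
    · rw [abs_of_nonpos h] at heq
      exact Or.inr ⟨y, hyG, by simp only; linarith⟩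
  have hsum : ENNReal.ofReal a ≤ ∑ j, (volume (T j) + volume (T j)) := by
    calc ENNReal.ofReal a = volume (Ioc 0 a) := by simp
      _ ≤ _ := measure_mono hcov
      _ ≤ ∑ j, _ := measure_iUnion_fintype_le _ _
      _ ≤ _ := by
        refine Finset.sum_le_sum fun j _ => (measure_union_le _ _).trans (le_of_eq ?_)
        rw [measure_preimage_add, (Measure.measurePreserving_sub_left volume (x j)).measure_preimage (hTm j).nullMeasurableSet]
  obtain ⟨j, hj⟩ : ∃ j, ENNReal.ofReal (a / (2 * (n+1))) ≤ volume (T j) := by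
    by_contra! hcon
    have : ∑ j, (volume (T j) + volume (T j)) < ∑ j : Fin (n+1),
        (ENNReal.ofReal (a / (2 * (n+1))) + ENNReal.ofReal (a / (2 * (n+1)))) :=
      ENNReal.sum_lt_sum_of_nonempty Finset.univ_nonempty fun j _ => ENNReal.add_lt_add (hcon j) (hcon j)
    have e : ∑ j : Fin (n+1),
        (ENNReal.ofReal (a / (2 * (n+1))) + ENNReal.ofReal (a / (2 * (n+1)))) = ENNReal.ofReal a := by
      rw [← ENNReal.ofReal_add (by positivity) (by positivity), ← ENNReal.ofReal_sum_of_nonneg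
        (fun _ _ => by positivity)]
      congr 1
      simp
      field_simp
      ring
    rw [e] at this
    exact absurd hsum (not_le.2 this)
  refine ⟨j, T j, hTm j, ?_, ?_, hj⟩
  · rintro s ⟨y, hy, rfl⟩
    have := abs_le.1 (hy.2 j)
    constructor <;> simp only <;> linarith [this.1, this.2]
  · rintro s ⟨y, hy, rfl⟩
    exact ⟨y, hy.1, hy.2, rfl⟩

theorem aux_combine {n : ℕ} {p : ℝ} (hp : 1 ≤ p) (hpn : (n:ℝ) < p)
    (u : EuclideanSpace ℝ (Fin (n+1)) → ℝ) (hu : ContDiff ℝ 1 u)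
    (x : EuclideanSpace ℝ (Fin (n+1))) (r : ℝ) (hr : 0 < r) (j : Fin (n+1)) (T : Set ℝ) (hT : MeasurableSet T)
    (hz : ∀ s ∈ T, ∃ z ∈ ball x r, z j = s ∧ u z = 0) (M : ENNReal)
    (hM : volume (ball x r) ≤ M * volume (ball x r ∩ {y | y j ∈ T})) :
    ∫⁻ y in ball x r, ‖u y‖ₑ ^ p ≤
      (M * (2 ^ (p-1) * (2 ^ p * 2 ^ (n+1) + (ENNReal.ofReal (p / (p - n)) * 2) ^ p))) *
        ENNReal.ofReal r ^ p * ∫⁻ y in ball x r, ‖fderiv ℝ u y‖ₑ ^ p := by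
  have hp0 : 0 < p := by linarith
  have hTm : MeasurableSet {y : EuclideanSpace ℝ (Fin (n+1)) | y j ∈ T} :=
    (show Measurable fun y : EuclideanSpace ℝ (Fin (n+1)) => y j by fun_prop) hT
  set B := ball x r with hB
  set S := B ∩ {y | y j ∈ T} with hS
  have hSB : S ⊆ B := inter_subset_left
  have hB0 : volume B ≠ 0 := (measure_ball_pos _ _ hr).ne'
  have hBt : volume B ≠ ⊤ := measure_ball_lt_top.ne
  have hm1 : Measurable fun y => ‖u y‖ₑ ^ p := hu.continuous.enorm.measurable.pow_const p
  have hm2 : Measurable fun q : EuclideanSpace ℝ (Fin (n+1)) × EuclideanSpace ℝ (Fin (n+1)) =>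
      ‖u q.1 - u q.2‖ₑ ^ p :=
    (show Continuous fun q : EuclideanSpace ℝ (Fin (n+1)) × EuclideanSpace ℝ (Fin (n+1)) =>
      u q.1 - u q.2 from (hu.continuous.comp continuous_fst).sub
        (hu.continuous.comp continuous_snd)).enorm.measurable.pow_const p
  set I := ∫⁻ y in B, ‖u y‖ₑ ^ p with hI
  set Gr := ∫⁻ y in B, ‖fderiv ℝ u y‖ₑ ^ p with hGr
  have hsl := aux_slice hp hpn u hu x r j T hT hz
  have hpair := aux_pair volume hp u hu B (convex_ball x r) measurableSet_ball (2 * r)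
    (fun y hy z hz => by
      have h1 : dist y x < r := hy
      have h2 : dist z x < r := hz
      rw [← dist_eq_norm]; linarith [dist_triangle_right y z x])
  have e2 : ENNReal.ofReal (2 * r) = 2 * ENNReal.ofReal r := by
    rw [ENNReal.ofReal_mul (by norm_num)]; simp
  have hmain : volume S * I ≤ 2 ^ (p-1) * ((∫⁻ y in B, ∫⁻ z in B, ‖u y - u z‖ₑ ^ p) +
      volume B * ∫⁻ z in S, ‖u z‖ₑ ^ p) := by
    have hmz : Measurable fun y => ∫⁻ z in S, ‖u y - u z‖ₑ ^ p := hm2.lintegral_prod_right'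
    calc volume S * I = ∫⁻ y in B, ∫⁻ z in S, ‖u y‖ₑ ^ p := by
          simp only [setLIntegral_const]
          rw [lintegral_mul_const _ hm1, mul_comm]
      _ ≤ ∫⁻ y in B, 2 ^ (p-1) * ((∫⁻ z in S, ‖u y - u z‖ₑ ^ p) + ∫⁻ z in S, ‖u z‖ₑ ^ p) := by
          refine lintegral_mono fun y => ?_
          have hmy : Measurable fun z => ‖u y - u z‖ₑ ^ p := hm2.comp measurable_prodMk_left
          rw [← lintegral_add_left hmy, ← lintegral_const_mul' _ _ (ENNReal.rpow_ne_top_of_nonneg (by linarith) (by simp))]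
          refine lintegral_mono fun z => ?_
          refine le_trans ?_ (ENNReal.rpow_add_le_mul_rpow_add_rpow _ _ hp)
          refine ENNReal.rpow_le_rpow ?_ hp0.le
          calc ‖u y‖ₑ = ‖(u y - u z) + u z‖ₑ := by rw [sub_add_cancel]
            _ ≤ _ := enorm_add_le _ _
      _ = 2 ^ (p-1) * ((∫⁻ y in B, ∫⁻ z in S, ‖u y - u z‖ₑ ^ p) +
            volume B * ∫⁻ z in S, ‖u z‖ₑ ^ p) := by
          rw [lintegral_const_mul _ (hmz.add_const _), lintegral_add_left hmz, setLIntegral_const,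
            mul_comm (volume B)]
      _ ≤ _ := by
          gcongr
  have hfr : Module.finrank ℝ (EuclideanSpace ℝ (Fin (n+1))) = n + 1 := by simp
  rw [hfr] at hpair
  have hfin : volume B * I ≤ volume B * ((M * (2 ^ (p-1) * (2 ^ p * 2 ^ (n+1) +
      (ENNReal.ofReal (p / (p - n)) * 2) ^ p))) * ENNReal.ofReal r ^ p * Gr) := by
    calc volume B * I ≤ M * volume S * I := by gcongr
      _ = M * (volume S * I) := by ring
      _ ≤ M * (2 ^ (p-1) * (ENNReal.ofReal (2 * r) ^ p * ((2 ^ (n+1) * volume B) * Gr) +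
        volume B * ((ENNReal.ofReal (p / (p - n)) * ENNReal.ofReal (2 * r)) ^ p * Gr))) := by
          refine mul_le_mul_right (hmain.trans ?_) _
          gcongr
      _ = _ := by
          rw [e2, ← mul_assoc (ENNReal.ofReal (p / (p - n))), ENNReal.mul_rpow_of_nonneg _ _ hp0.le,
            ENNReal.mul_rpow_of_nonneg (_ * _) _ hp0.le]
          ring
  exact (ENNReal.mul_le_mul_iff_right hB0 hBt).1 hfin

theorem aux_inradius {N : ℕ} (Ω : Set (EuclideanSpace ℝ (Fin N))) (ho : IsOpen Ω) (hne : Ω.Nonempty)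
    (hb : Bornology.IsBounded Ω) (x : EuclideanSpace ℝ (Fin N)) (hx : x ∉ Ω) :
    0 < inradius N Ω ∧ ∃ c R, inradius N Ω / 2 < R ∧ ball c R ⊆ Ω := by
  obtain ⟨c0, hc0⟩ := hne
  obtain ⟨ε, hε, hball⟩ := Metric.isOpen_iff.1 ho c0 hc0
  obtain ⟨M, hM⟩ := (Metric.isBounded_iff_subset_closedBall x).1 hb
  have hbdd : BddAbove { r | ∃ c : EuclideanSpace ℝ (Fin N), Metric.ball c r ⊆ Ω } := by
    refine ⟨|M|, ?_⟩
    rintro R ⟨c, hc⟩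
    by_contra! hlt
    have hR : 0 < R := (abs_nonneg M).trans_lt hlt
    have h1 : dist c x ≤ M := hM (hc (mem_ball_self hR))
    apply hx
    apply hc
    rw [mem_ball, dist_comm]
    linarith [le_abs_self M]
  have hmem : ε ∈ { r | ∃ c : EuclideanSpace ℝ (Fin N), Metric.ball c r ⊆ Ω } := ⟨c0, hball⟩
  have hpos : 0 < inradius N Ω := hε.trans_le (le_csSup hbdd hmem)
  obtain ⟨R, ⟨c, hc⟩, hR⟩ := exists_lt_of_lt_csSup (b := inradius N Ω / 2) (⟨ε, hmem⟩ : { r | ∃ c : EuclideanSpace ℝ (Fin N), Metric.ball c r ⊆ Ω }.Nonempty)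
    (show inradius N Ω / 2 < sSup _ from half_lt_self hpos)
  exact ⟨hpos, c, R, hR, hc⟩

theorem aux_no_one (Ω : Set (EuclideanSpace ℝ (Fin 1))) (ho : IsOpen Ω) (hne : Ω.Nonempty)
    (hb : Bornology.IsBounded Ω) (hF : IsConnected (frontier Ω))
    (x : EuclideanSpace ℝ (Fin 1)) (hx : x ∈ frontier Ω) : False := by
  have hFΩ : ∀ y ∈ frontier Ω, y ∉ Ω := fun y hy => by
    have := hy.2; rwa [ho.interior_eq] at this
  obtain ⟨c, hc⟩ := hne
  have hcx : c ≠ x := fun h => hFΩ x hx (h ▸ hc)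
  obtain ⟨t, ht, hz⟩ := aux_ray Ω hb c x hc hcx ho
  have key : c 0 ∈ (fun y : EuclideanSpace ℝ (Fin 1) => y 0) '' frontier Ω := by
    have hcont : ContinuousOn (fun y : EuclideanSpace ℝ (Fin 1) => y 0) (frontier Ω) := by fun_prop
    rcases le_total (x 0) (c 0) with h | h
    · refine hF.isPreconnected.intermediate_value hx hz hcont ⟨h, ?_⟩
      simp
      exact mul_nonneg ht (by linarith)
    · refine hF.isPreconnected.intermediate_value hz hx hcont ⟨?_, h⟩
      simp
      exact mul_nonpos_of_nonneg_of_nonpos ht (by linarith)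
  obtain ⟨y, hy, hyc⟩ := key
  have : y = c := by
    ext i
    rw [Subsingleton.elim i 0]; exact hyc
  exact hFΩ y hy (this ▸ hc)

theorem aux_final (n : ℕ) (p : ℝ) (hn : 1 ≤ n) (hpn : (n:ℝ) < p) :
    ∃ K : ENNReal, K ≠ ⊤ ∧ ∀ (Ω : Set (EuclideanSpace ℝ (Fin (n+1)))),
      IsOpen Ω → IsConnected Ω → Bornology.IsBounded Ω → IsConnected (frontier Ω) →
      ∀ x ∈ frontier Ω, ∀ u : EuclideanSpace ℝ (Fin (n+1)) → ℝ,
      ContDiff ℝ 1 u → tsupport u ⊆ Ω →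
      0 < inradius (n+1) Ω * (1 + Real.sqrt (n+1 : ℕ)) ∧
      ∫⁻ y in Metric.ball x (inradius (n+1) Ω * (1 + Real.sqrt (n+1 : ℕ))), ‖u y‖ₑ ^ p ≤
        K * ENNReal.ofReal (inradius (n+1) Ω * (1 + Real.sqrt (n+1 : ℕ))) ^ p *
          ∫⁻ y in Metric.ball x (inradius (n+1) Ω * (1 + Real.sqrt (n+1 : ℕ))), ‖fderiv ℝ u y‖ₑ ^ p := by
  have hp : 1 ≤ p := by
    have : (1:ℝ) ≤ n := by exact_mod_cast hn
    linarith
  have hp0 : 0 < p := by linarith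
  set κ : ℝ := 1 + Real.sqrt (n+1 : ℕ) with hκ
  have hκ1 : 1 ≤ κ := by have := Real.sqrt_nonneg ((n+1 : ℕ):ℝ); linarith
  have hn1 : (0:ℝ) < n + 1 := by positivity
  set v : ENNReal := volume (ball (0 : EuclideanSpace ℝ (Fin (n+1))) 1) with hv
  set M : ENNReal := v * ENNReal.ofReal (κ ^ (n+1) * (4 * (n+1)^2) * (n+1) ^ n) with hM
  have hMt : M ≠ ⊤ := ENNReal.mul_ne_top measure_ball_lt_top.ne ENNReal.ofReal_ne_top
  refine ⟨M * (2 ^ (p-1) * (2 ^ p * 2 ^ (n+1) + (ENNReal.ofReal (p / (p - n)) * 2) ^ p)), ?_, ?_⟩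
  · refine ENNReal.mul_ne_top hMt (ENNReal.mul_ne_top
      (ENNReal.rpow_ne_top_of_nonneg (by linarith) (by simp)) (ENNReal.add_ne_top.2 ⟨ENNReal.mul_ne_top
      (ENNReal.rpow_ne_top_of_nonneg hp0.le (by simp)) (by simp), ?_⟩))
    exact ENNReal.rpow_ne_top_of_nonneg hp0.le (ENNReal.mul_ne_top ENNReal.ofReal_ne_top (by simp))
  intro Ω ho hc hb hF x hx u hu hsupp
  have hFΩ : ∀ y ∈ frontier Ω, y ∉ Ω := fun y hy => by
    have := hy.2; rwa [ho.interior_eq] at this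
  obtain ⟨hρ, c, R, hR, hball⟩ := aux_inradius Ω ho hc.nonempty hb x (hFΩ x hx)
  set ρ := inradius (n+1) Ω with hρdef
  have hr : 0 < ρ * κ := by positivity
  refine ⟨hr, ?_⟩
  have hR0 : 0 < R := by linarith
  have hcΩ : c ∈ Ω := hball (mem_ball_self hR0)
  have hcx : c ≠ x := fun h => hFΩ x hx (h ▸ hcΩ)
  have hdist : R ≤ ‖c - x‖ := by
    by_contra! h
    refine hFΩ x hx (hball ?_)
    rwa [mem_ball, dist_comm, dist_eq_norm]
  obtain ⟨t, ht, hz⟩ := aux_ray Ω hb c x hcΩ hcx ho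
  set a : ℝ := ρ / (2 * (n+1)) with ha
  have ha0 : 0 < a := by positivity
  have hna : (n+1) * a = ρ / 2 := by rw [ha]; field_simp
  have hzn : (n+1) * a < ‖(c + t • (c - x)) - x‖ := by
    have e : (c + t • (c - x)) - x = (1 + t) • (c - x) := by module
    rw [e, norm_smul, Real.norm_of_nonneg (by linarith), hna]
    nlinarith
  have hFcomp : IsCompact (frontier Ω) :=
    (hb.isCompact_closure).of_isClosed_subset isClosed_frontier frontier_subset_closure
  obtain ⟨j, T, hTm, hTa, hTF, hTv⟩ := aux_pick (frontier Ω) hFcomp hF.isPreconnected x hx a ha0 _ hz hzn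
  have hra : (n+1) * a < ρ * κ := by rw [hna]; nlinarith
  have hvol := aux_vol x (ρ * κ) a ha0.le hra j T hTm hTa
  refine aux_combine hp hpn u hu x (ρ * κ) hr j T hTm ?_ M ?_
  · intro s hs
    obtain ⟨y, hy, hya, hyj⟩ := hTF s hs
    refine ⟨y, ?_, hyj, ?_⟩
    · rw [mem_ball, dist_eq_norm]
      exact (aux_norm_le (y - x) a ha0.le hya).trans_lt hra
    · exact image_eq_zero_of_notMem_tsupport fun h => hFΩ y hy (hsupp h)
  · calc volume (ball x (ρ * κ)) = ENNReal.ofReal ((ρ * κ) ^ (n+1)) * v := by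
          rw [Measure.addHaar_ball_of_pos _ _ hr]; simp [hv]
      _ = M * (ENNReal.ofReal (a / (2 * (n+1))) * ENNReal.ofReal (2 * a) ^ n) := by
          rw [hM, mul_comm _ v, mul_assoc v, ← ENNReal.ofReal_pow (by positivity),
            ← ENNReal.ofReal_mul (by positivity), ← ENNReal.ofReal_mul (by positivity)]
          congr 2
          have e : 2 * a = ρ / (n+1) := by rw [ha]; field_simp
          rw [e, ha, div_pow, mul_pow, pow_succ ρ]
          field_simp
          ring
      _ ≤ _ := by
          refine mul_le_mul_right (le_trans ?_ hvol) _
          gcongr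

theorem local_boundary_poincare (N : ℕ) (p : ℝ) (hp : (N : ℝ) - 1 < p) :
    ∃ C : ℝ, 0 < C ∧ ∀ (Ω : Set (EuclideanSpace ℝ (Fin N))),
      IsOpen Ω → IsConnected Ω → Bornology.IsBounded Ω → IsConnected (frontier Ω) →
      ∀ x ∈ frontier Ω, ∀ u : EuclideanSpace ℝ (Fin N) → ℝ,
      ContDiff ℝ (⊤ : ℕ∞) u → HasCompactSupport u → tsupport u ⊆ Ω →
      ∫ y in Metric.ball x (inradius N Ω * (1 + Real.sqrt N)), |u y| ^ p ≤
        C * (inradius N Ω * (1 + Real.sqrt N)) ^ p *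
          ∫ y in Metric.ball x (inradius N Ω * (1 + Real.sqrt N)), ‖fderiv ℝ u y‖ ^ p := by
  match N, hp with
  | 0, _ =>
    refine ⟨1, one_pos, ?_⟩
    intro Ω ho hc hb hF x hx
    exfalso
    obtain ⟨c, hcΩ⟩ := hc.nonempty
    have := hx.2
    rw [ho.interior_eq, Subsingleton.elim x c] at this
    exact this hcΩ
  | 1, _ =>
    refine ⟨1, one_pos, ?_⟩
    intro Ω ho hc hb hF x hx
    exact (aux_no_one Ω ho hc.nonempty hb hF x hx).elim
  | m + 2, hp =>
    have hpn : ((m+1 : ℕ) : ℝ) < p := by push_cast at hp ⊢; linarith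
    have hp0 : 0 < p := lt_of_le_of_lt (by positivity) hpn
    obtain ⟨K, hK, hmain⟩ := aux_final (m+1) p (by omega) hpn
    refine ⟨K.toReal + 1, by positivity, ?_⟩
    intro Ω ho hc hb hF x hx u hu hcs hsupp
    have hu1 : ContDiff ℝ 1 u := hu.of_le (by exact_mod_cast le_top)
    obtain ⟨hr, hle⟩ := hmain Ω ho hc hb hF x hx u hu1 hsupp
    set r := inradius (m+2) Ω * (1 + Real.sqrt (m+2 : ℕ)) with hrdef
    have hfd : Continuous (fderiv ℝ u) := hu1.continuous_fderiv one_ne_zero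
    have hf1 : Continuous fun y => |u y| ^ p :=
      hu1.continuous.abs.rpow_const fun _ => Or.inr hp0.le
    have hf2 : Continuous fun y => ‖fderiv ℝ u y‖ ^ p :=
      hfd.norm.rpow_const fun _ => Or.inr hp0.le
    have hi2 : IntegrableOn (fun y => ‖fderiv ℝ u y‖ ^ p) (ball x r) :=
      (hf2.continuousOn.integrableOn_compact (isCompact_closedBall x r)).mono_set ball_subset_closedBall
    have e1 : ∫ y in ball x r, |u y| ^ p = (∫⁻ y in ball x r, ‖u y‖ₑ ^ p).toReal := by
      rw [integral_eq_lintegral_of_nonneg_ae (Filter.Eventually.of_forall fun y => by positivity)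
        hf1.aestronglyMeasurable]
      congr 2; ext y
      rw [← ENNReal.ofReal_rpow_of_nonneg (abs_nonneg _) hp0.le, ← Real.norm_eq_abs, ofReal_norm]
    have e2' : ∫⁻ y in ball x r, ENNReal.ofReal (‖fderiv ℝ u y‖ ^ p) =
        ∫⁻ y in ball x r, ‖fderiv ℝ u y‖ₑ ^ p := by
      congr 1; ext y
      rw [← ENNReal.ofReal_rpow_of_nonneg (norm_nonneg _) hp0.le, ofReal_norm]
    have e2 : ∫ y in ball x r, ‖fderiv ℝ u y‖ ^ p = (∫⁻ y in ball x r, ‖fderiv ℝ u y‖ₑ ^ p).toReal := by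
      rw [integral_eq_lintegral_of_nonneg_ae (Filter.Eventually.of_forall fun y => by positivity)
        hf2.aestronglyMeasurable, e2']
    have hfin : ∫⁻ y in ball x r, ‖fderiv ℝ u y‖ₑ ^ p ≠ ⊤ := by
      rw [← e2']
      exact hi2.lintegral_lt_top.ne
    rw [e1, e2]
    calc _ ≤ (K * ENNReal.ofReal r ^ p * ∫⁻ y in ball x r, ‖fderiv ℝ u y‖ₑ ^ p).toReal := by
          refine ENNReal.toReal_mono ?_ hle
          exact ENNReal.mul_ne_top (ENNReal.mul_ne_top hK
            (ENNReal.rpow_ne_top_of_nonneg hp0.le ENNReal.ofReal_ne_top)) hfin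
      _ = K.toReal * r ^ p * (∫⁻ y in ball x r, ‖fderiv ℝ u y‖ₑ ^ p).toReal := by
          rw [ENNReal.toReal_mul, ENNReal.toReal_mul, ← ENNReal.toReal_rpow,
            ENNReal.toReal_ofReal hr.le]
      _ ≤ _ := by
          gcongr
          linarith
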